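/- There exists an involutive Jamesian function J which is not transitive; that is, there exists J : (0,1) × (0,1) → (0,1) satisfying the three Jamesian axioms together with points a, b, c ∈ (0,1) such that J(J(a,c), J(b,c)) ≠ J(a,b). Equivalently (by the characterization of representability), there exists an involutive Jamesian function which is not f-representable. -/

import Mathlib

open Set

/-- `J` is an involutive Jamesian function on `(0,1)`: it maps
`(0,1) x (0,1)` into `(0,1)`, satisfies the involutive property
`J a (J a b) = b`, satisfies `J a b + J b a = 1`, and for each fixed
`b0 in (0,1)` the map `a => J a b0` is strictly increasing. -/
def IsJamesian (J : ℝ → ℝ → ℝ) : Prop :=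
  (∀ a ∈ Set.Ioo (0:ℝ) 1, ∀ b ∈ Set.Ioo (0:ℝ) 1, J a b ∈ Set.Ioo (0:ℝ) 1) ∧
  (∀ a ∈ Set.Ioo (0:ℝ) 1, ∀ b ∈ Set.Ioo (0:ℝ) 1, J a (J a b) = b) ∧
  (∀ a ∈ Set.Ioo (0:ℝ) 1, ∀ b ∈ Set.Ioo (0:ℝ) 1, J a b + J b a = 1) ∧
  (∀ b₀ ∈ Set.Ioo (0:ℝ) 1, StrictMonoOn (fun a => J a b₀) (Set.Ioo 0 1))

/-- `J` is `f`-representable: there is a strictly increasing homeomorphism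
`f : (0,1) → ℝ` (with inverse `g`) satisfying `f (1 - a) = - f a`, such that
`J a b = f⁻¹ (f a - f b)`. -/
def IsRepresentable (J : ℝ → ℝ → ℝ) : Prop :=
  ∃ f g : ℝ → ℝ,
    ContinuousOn f (Set.Ioo 0 1) ∧
    StrictMonoOn f (Set.Ioo 0 1) ∧
    Continuous g ∧
    (∀ y : ℝ, g y ∈ Set.Ioo (0:ℝ) 1) ∧
    (∀ x ∈ Set.Ioo (0:ℝ) 1, g (f x) = x) ∧
    (∀ y : ℝ, f (g y) = y) ∧
    (∀ a ∈ Set.Ioo (0:ℝ) 1, f (1 - a) = - f a) ∧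
    (∀ a ∈ Set.Ioo (0:ℝ) 1, ∀ b ∈ Set.Ioo (0:ℝ) 1, J a b = g (f a - f b))

/-- `J` is transitive: `J (J a c) (J b c) = J a b` on `(0,1)`. -/
def IsTransitive (J : ℝ → ℝ → ℝ) : Prop :=
  ∀ a ∈ Set.Ioo (0:ℝ) 1, ∀ b ∈ Set.Ioo (0:ℝ) 1, ∀ c ∈ Set.Ioo (0:ℝ) 1,
    J (J a c) (J b c) = J a b

/-- A deformation of the subtraction `x - y`: `z = medianSub x y` is the solution of
`x - y - z + median (x, -y, -z) = 0`, an equation that is invariant under permutations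
and under a global sign change of `(x, -y, -z)`. -/
noncomputable def medianSub (x y : ℝ) : ℝ :=
  x - y + max (min x (-y)) (min (max x (-y)) ((y - x) / 2))

lemma medianSub_medianSub (x y : ℝ) : medianSub x (medianSub x y) = y := by
  unfold medianSub
  grind

lemma medianSub_swap (x y : ℝ) : medianSub y x = -medianSub x y := by
  unfold medianSub
  grind

lemma strictMono_medianSub_left (y : ℝ) : StrictMono fun x => medianSub x y := by
  intro x x' h
  simp only [medianSub]
  grind

/-- The function on `(0,1)` obtained from `medianSub` by transport along the sigmoid. -/
noncomputable def medianJ (a b : ℝ) : ℝ :=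
  Real.sigmoid (medianSub (Function.invFun Real.sigmoid a) (Function.invFun Real.sigmoid b))

lemma medianJ_sigmoid (x y : ℝ) :
    medianJ (Real.sigmoid x) (Real.sigmoid y) = Real.sigmoid (medianSub x y) := by
  simp only [medianJ, Function.leftInverse_invFun Real.sigmoid_injective _]

lemma sigmoid_mem_Ioo (x : ℝ) : Real.sigmoid x ∈ Ioo (0 : ℝ) 1 :=
  ⟨Real.sigmoid_pos x, Real.sigmoid_lt_one x⟩

lemma exists_sigmoid_eq {a : ℝ} (ha : a ∈ Ioo (0 : ℝ) 1) : ∃ x, Real.sigmoid x = a := by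
  rwa [← Real.range_sigmoid] at ha

lemma isJamesian_medianJ : IsJamesian medianJ := by
  refine ⟨fun a _ b _ => sigmoid_mem_Ioo _, fun a ha b hb => ?_, fun a ha b hb => ?_,
    fun b hb a ha a' ha' h => ?_⟩
  · obtain ⟨x, rfl⟩ := exists_sigmoid_eq ha
    obtain ⟨y, rfl⟩ := exists_sigmoid_eq hb
    simp only [medianJ_sigmoid, medianSub_medianSub]
  · obtain ⟨x, rfl⟩ := exists_sigmoid_eq ha
    obtain ⟨y, rfl⟩ := exists_sigmoid_eq hb
    rw [medianJ_sigmoid, medianJ_sigmoid, medianSub_swap x y, Real.sigmoid_neg]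
    ring
  · obtain ⟨x, rfl⟩ := exists_sigmoid_eq ha
    obtain ⟨x', rfl⟩ := exists_sigmoid_eq ha'
    obtain ⟨y, rfl⟩ := exists_sigmoid_eq hb
    simp only [medianJ_sigmoid]
    exact Real.sigmoid_strictMono
      (strictMono_medianSub_left y (Real.sigmoid_strictMono.lt_iff_lt.mp h))

lemma medianJ_transitivity_fails :
    medianJ (medianJ (Real.sigmoid 3) (Real.sigmoid 2))
      (medianJ (Real.sigmoid 1) (Real.sigmoid 2)) ≠
      medianJ (Real.sigmoid 3) (Real.sigmoid 1) := by
  simp only [medianJ_sigmoid]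
  refine Real.sigmoid_injective.ne ?_
  have h₁ : medianSub 3 2 = 1 / 2 := by unfold medianSub; grind
  have h₂ : medianSub 1 2 = -1 / 2 := by unfold medianSub; grind
  have h₃ : medianSub (1 / 2) (-1 / 2) = 3 / 2 := by unfold medianSub; grind
  have h₄ : medianSub 3 1 = 1 := by unfold medianSub; grind
  rw [h₁, h₂, h₃, h₄]
  norm_num

lemma IsRepresentable.isTransitive {J : ℝ → ℝ → ℝ} (hJ : IsRepresentable J) :
    IsTransitive J := by
  obtain ⟨f, g, -, -, -, hg, -, hfg, -, h⟩ := hJ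
  intro a ha b hb c hc
  rw [h a ha c hc, h b hb c hc, h _ (hg _) _ (hg _), hfg, hfg, h a ha b hb,
    sub_sub_sub_cancel_right]

/-- there exists an involutive Jamesian function which is not
transitive; equivalently, there exists one which is not `f`-representable. -/
theorem stmt_17 :
    (∃ J : ℝ → ℝ → ℝ, IsJamesian J ∧
      ∃ a ∈ Ioo (0:ℝ) 1, ∃ b ∈ Ioo (0:ℝ) 1, ∃ c ∈ Ioo (0:ℝ) 1,
        J (J a c) (J b c) ≠ J a b) ∧
    (∃ J : ℝ → ℝ → ℝ, IsJamesian J ∧ ¬ IsRepresentable J) := by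
  exact ⟨⟨medianJ, isJamesian_medianJ, _, sigmoid_mem_Ioo 3, _, sigmoid_mem_Ioo 1, _,
      sigmoid_mem_Ioo 2, medianJ_transitivity_fails⟩,
    medianJ, isJamesian_medianJ, fun hJ => medianJ_transitivity_fails <|
      hJ.isTransitive _ (sigmoid_mem_Ioo 3) _ (sigmoid_mem_Ioo 1) _ (sigmoid_mem_Ioo 2)⟩
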